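/- For any finite nonempty set A of nonzero real numbers, |A/A + A| ≫ |A/A|^{3/4} · |A|^{1/2}. -/

import Mathlib

open Finset

/-- Number of elements of `S` not exceeding `x`. -/
noncomputable def rk (S : Finset ℝ) (x : ℝ) : ℕ := (S.filter (fun s => s ≤ x)).card

lemma rk_mono (S : Finset ℝ) {x y : ℝ} (h : x ≤ y) : rk S x ≤ rk S y := by
  unfold rk
  apply card_le_card
  intro s hs
  rw [mem_filter] at hs ⊢
  exact ⟨hs.1, hs.2.trans h⟩

lemma rk_lt (S : Finset ℝ) {x y : ℝ} (h : x < y) (hy : y ∈ S) : rk S x < rk S y := by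
  unfold rk
  apply card_lt_card
  rw [Finset.ssubset_iff_of_subset]
  · exact ⟨y, by simp [hy], by simp [h]⟩
  · intro s hs
    rw [mem_filter] at hs ⊢
    exact ⟨hs.1, hs.2.trans h.le⟩

lemma rk_le (S : Finset ℝ) (x : ℝ) : rk S x ≤ S.card := card_filter_le _ _

/-- Close pairs in `S`. -/
noncomputable def closeP (S : Finset ℝ) (m : ℕ) : Finset (Σ _ : ℝ, ℝ) :=
  S.sigma (fun u => S.filter (fun v => u < v ∧ m * rk S v ≤ m * rk S u + 4 * S.card))

lemma closeP_card (S : Finset ℝ) (m : ℕ) (hm : 0 < m) :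
    (closeP S m).card * m ≤ 4 * S.card * S.card := by
  have h1 : (closeP S m).card ≤ S.card * (4 * S.card / m) := by
    unfold closeP
    rw [card_sigma, ← smul_eq_mul (S.card)]
    apply Finset.sum_le_card_nsmul
    intro u _
    have : (Finset.Icc 1 (4 * S.card / m)).card = 4 * S.card / m := by simp
    rw [← this]
    apply Finset.card_le_card_of_injOn (fun v => rk S v - rk S u)
    · intro v hv
      simp only [coe_filter, Set.mem_setOf_eq] at hv
      obtain ⟨hv, huv, hk⟩ := hv
      have := rk_lt S huv hv
      simp only [coe_Icc, Set.mem_Icc]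
      refine ⟨by omega, ?_⟩
      rw [Nat.le_div_iff_mul_le hm, Nat.sub_mul]
      rw [mul_comm m, mul_comm m] at hk
      omega
    · intro v hv w hw hvw
      simp only [coe_filter, Set.mem_setOf_eq] at hv hw
      have h1 := rk_lt S hv.2.1 hv.1
      have h2 := rk_lt S hw.2.1 hw.1
      simp only at hvw
      rcases lt_trichotomy v w with h | h | h
      · have := rk_lt S h hw.1
        omega
      · exact h
      · have := rk_lt S h hv.1
        omega
  calc (closeP S m).card * m ≤ S.card * (4 * S.card / m) * m := Nat.mul_le_mul_right _ h1
    _ = S.card * (4 * S.card / m * m) := by ring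
    _ ≤ S.card * (4 * S.card) := Nat.mul_le_mul_left _ (Nat.div_mul_le_self _ _)
    _ = _ := by ring

lemma bad_count (G : ℕ → ℤ) (m : ℕ) (N : ℤ) (hN : 0 < N)
    (hG : ∀ i < m, G i ≤ G (i + 1)) (hT : G m - G 0 ≤ N) :
    4 * ((range m).filter (fun i => ¬ (m * G (i + 1) ≤ m * G i + 4 * N))).card ≤ m := by
  set Bd := (range m).filter (fun i => ¬ (m * G (i + 1) ≤ m * G i + 4 * N)) with hB
  have h1 : (Bd.card : ℤ) * (4 * N) ≤ ∑ i ∈ Bd, (m : ℤ) * (G (i + 1) - G i) := by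
    rw [← nsmul_eq_mul]
    apply Finset.card_nsmul_le_sum
    intro i hi
    rw [hB, mem_filter] at hi
    have := hi.2
    rw [mul_sub]
    omega
  have h2 : ∑ i ∈ Bd, (m : ℤ) * (G (i + 1) - G i)
      ≤ ∑ i ∈ range m, (m : ℤ) * (G (i + 1) - G i) := by
    apply Finset.sum_le_sum_of_subset_of_nonneg (filter_subset _ _)
    intro i hi _
    have := hG i (mem_range.1 hi)
    apply mul_nonneg <;> omega
  rw [← Finset.mul_sum (range m), Finset.sum_range_sub] at h2
  have h3 : (m : ℤ) * (G m - G 0) ≤ m * N := by gcongr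
  have h4 : (4 * (Bd.card : ℤ)) * N ≤ m * N := by linarith
  have := le_of_mul_le_mul_right h4 hN
  exact_mod_cast this

lemma uniq_pos {a b x y : ℝ} (ha : 0 < a) (hx : 0 < x) (hab : a < b) (hxy : x < y)
    (h1 : b - a = y - x) (h2 : a⁻¹ - b⁻¹ = x⁻¹ - y⁻¹) : a = x := by
  have hb : 0 < b := ha.trans hab
  have hy : 0 < y := hx.trans hxy
  have e1 : a⁻¹ - b⁻¹ = (b - a) / (a * b) := by field_simp
  have e2 : x⁻¹ - y⁻¹ = (b - a) / (x * y) := by rw [h1]; field_simp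
  rw [e1, e2, div_eq_div_iff (by positivity) (by positivity)] at h2
  have h3 : x * y = a * b := mul_left_cancel₀ (sub_pos.2 hab).ne' h2
  have hbb : b = a + (y - x) := by linarith
  subst hbb
  have : (a - x) * (a + y) = 0 := by linarith
  rcases mul_eq_zero.1 this with h | h
  · linarith
  · linarith

lemma main_seq (p : ℕ → ℝ) (m : ℕ) (hm : 0 < m) (hp : ∀ i ≤ m, 0 < p i)
    (hlt : ∀ i j, i < j → j ≤ m → p i < p j) (C D S : Finset ℝ) (hS : 0 < S.card)
    (h1 : ∀ i ≤ m, ∀ c ∈ C, p i + c ∈ S) (h2 : ∀ i ≤ m, ∀ d ∈ D, (p i)⁻¹ + d ∈ S) :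
    m ^ 3 * (C.card * D.card) ≤ 32 * S.card ^ 4 := by
  classical
  let g1 : ℝ → ℕ → Prop := fun c i =>
    m * rk S (p (i + 1) + c) ≤ m * rk S (p i + c) + 4 * S.card
  let g2 : ℝ → ℕ → Prop := fun d i =>
    m * rk S ((p i)⁻¹ + d) ≤ m * rk S ((p (i + 1))⁻¹ + d) + 4 * S.card
  have b1 : ∀ c, 4 * ((range m).filter (fun i => ¬ g1 c i)).card ≤ m := by
    intro c
    have := bad_count (fun i => (rk S (p i + c) : ℤ)) m S.card (by exact_mod_cast hS)
      (fun i hi => by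
        have := hlt i (i + 1) (by omega) (by omega)
        exact_mod_cast rk_mono S (by linarith))
      (by have := rk_le S (p m + c); omega)
    convert this using 5
    simp only [g1]
    norm_cast
  have hinv : ∀ i < m, (p (i + 1))⁻¹ < (p i)⁻¹ := fun i hi =>
    inv_strictAnti₀ (hp i hi.le) (hlt i (i + 1) (by omega) (by omega))
  have b2 : ∀ d, 4 * ((range m).filter (fun i => ¬ g2 d i)).card ≤ m := by
    intro d
    have := bad_count (fun i => -(rk S ((p i)⁻¹ + d) : ℤ)) m S.card (by exact_mod_cast hS)
      (fun i hi => by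
        have := hinv i hi
        have : rk S ((p (i + 1))⁻¹ + d) ≤ rk S ((p i)⁻¹ + d) := rk_mono S (by linarith)
        omega)
      (by have := rk_le S ((p 0)⁻¹ + d); omega)
    convert this using 5
    simp only [g2]
    zify
    constructor <;> intro h <;> linarith
  let X : Finset (Σ _ : ℝ × ℝ, ℕ) :=
    (C ×ˢ D).sigma (fun cd => (range m).filter (fun i => g1 cd.1 i ∧ g2 cd.2 i))
  have hX : (C.card * D.card) * m ≤ 2 * X.card := by
    simp only [X]
    rw [card_sigma, mul_sum, ← card_product, ← smul_eq_mul]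
    apply Finset.card_nsmul_le_sum
    intro cd _
    have e1 := b1 cd.1
    have e2 := b2 cd.2
    have e3 : range m ⊆ (range m).filter (fun i => g1 cd.1 i ∧ g2 cd.2 i) ∪
        ((range m).filter (fun i => ¬ g1 cd.1 i) ∪ (range m).filter (fun i => ¬ g2 cd.2 i)) := by
      intro i hi
      simp only [mem_union, mem_filter, hi, true_and]
      tauto
    have e4 := card_le_card e3
    have e5 := card_union_le ((range m).filter (fun i => g1 cd.1 i ∧ g2 cd.2 i))
        ((range m).filter (fun i => ¬ g1 cd.1 i) ∪ (range m).filter (fun i => ¬ g2 cd.2 i))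
    have e6 := card_union_le ((range m).filter (fun i => ¬ g1 cd.1 i))
      ((range m).filter (fun i => ¬ g2 cd.2 i))
    rw [card_range] at e4
    omega
  have hXT : X.card ≤ (closeP S m ×ˢ closeP S m).card := by
    apply Finset.card_le_card_of_injOn
      (fun x => ((⟨p x.2 + x.1.1, p (x.2 + 1) + x.1.1⟩,
        ⟨(p (x.2 + 1))⁻¹ + x.1.2, (p x.2)⁻¹ + x.1.2⟩) :
          (Σ _ : ℝ, ℝ) × (Σ _ : ℝ, ℝ)))
    · rintro ⟨⟨c, d⟩, i⟩ hx
      simp only [X, mem_coe, mem_sigma, mem_product, mem_filter, mem_range] at hx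
      obtain ⟨⟨hc, hd⟩, hi, hg1, hg2⟩ := hx
      simp only [closeP, mem_coe, mem_sigma, mem_product, mem_filter]
      refine ⟨⟨h1 _ hi.le _ hc, h1 _ hi _ hc, ?_, hg1⟩, ⟨h2 _ hi _ hd, h2 _ hi.le _ hd, ?_, hg2⟩⟩
      · have := hlt i (i + 1) (by omega) (by omega)
        linarith
      · have := hinv i hi
        linarith
    · rintro ⟨⟨c, d⟩, i⟩ hx ⟨⟨c', d'⟩, j⟩ hy hxy
      simp only [X, mem_coe, mem_sigma, mem_product, mem_filter, mem_range] at hx hy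
      have hi := hx.2.1
      have hj := hy.2.1
      simp only [Prod.mk.injEq, Sigma.mk.injEq, heq_eq_eq] at hxy
      obtain ⟨⟨q1, q2⟩, q3, q4⟩ := hxy
      have hpe : p i = p j := uniq_pos (hp i hi.le) (hp j hj.le)
        (hlt i (i + 1) (by omega) (by omega)) (hlt j (j + 1) (by omega) (by omega))
        (by linarith) (by linarith)
      have hij : i = j := by
        rcases lt_trichotomy i j with h | h | h
        · have := hlt i j h hj.le
          linarith
        · exact h
        · have := hlt j i h hi.le
          linarith
      subst hij
      have hc : c = c' := by linarith
      have hd : d = d' := by linarith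
      rw [hc, hd]
  rw [card_product] at hXT
  have hT := closeP_card S m hm
  calc m ^ 3 * (C.card * D.card) = ((C.card * D.card) * m) * m ^ 2 := by ring
    _ ≤ (2 * ((closeP S m).card * (closeP S m).card)) * m ^ 2 :=
        Nat.mul_le_mul_right _ (hX.trans (Nat.mul_le_mul_left _ hXT))
    _ = 2 * (((closeP S m).card * m) * ((closeP S m).card * m)) := by ring
    _ ≤ 2 * ((4 * S.card * S.card) * (4 * S.card * S.card)) :=
        Nat.mul_le_mul_left _ (Nat.mul_le_mul hT hT)
    _ = _ := by ring

lemma main_pos (P C S : Finset ℝ) (hP : ∀ x ∈ P, 0 < x)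
    (h1 : ∀ x ∈ P, ∀ c ∈ C, x + c ∈ S) (h2 : ∀ x ∈ P, ∀ c ∈ C, x⁻¹ + c ∈ S) :
    P.card ^ 3 * (C.card * C.card) ≤ 256 * S.card ^ 4 := by
  rcases C.eq_empty_or_nonempty with rfl | ⟨c0, hc0⟩
  · simp
  rcases P.eq_empty_or_nonempty with rfl | ⟨x0, hx0⟩
  · simp
  have hS : 0 < S.card := card_pos.2 ⟨_, h1 x0 hx0 c0 hc0⟩
  have hn : 0 < P.card := card_pos.2 ⟨_, hx0⟩
  obtain ⟨m, hm⟩ : ∃ m, P.card = m + 1 := ⟨P.card - 1, by omega⟩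
  rcases Nat.eq_zero_or_pos m with h0 | hmp
  · have hCS : C.card ≤ S.card := by
      apply Finset.card_le_card_of_injOn (fun c => x0 + c)
      · intro c hc
        exact h1 x0 hx0 c hc
      · intro a _ b _ hab
        simpa using hab
    rw [hm, h0]
    calc (0 + 1) ^ 3 * (C.card * C.card) ≤ S.card * S.card := by
          rw [zero_add, one_pow, one_mul]; exact Nat.mul_le_mul hCS hCS
      _ = S.card ^ 2 := by ring
      _ ≤ S.card ^ 4 := Nat.pow_le_pow_right hS (by norm_num)
      _ ≤ _ := by omega
  · let f := P.orderEmbOfFin hm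
    let p : ℕ → ℝ := fun i => if h : i < m + 1 then f ⟨i, h⟩ else 0
    have hpP : ∀ i ≤ m, p i ∈ P := by
      intro i hi
      have : i < m + 1 := by omega
      simp only [p, this, dif_pos]
      exact P.orderEmbOfFin_mem hm _
    have hlt : ∀ i j, i < j → j ≤ m → p i < p j := by
      intro i j hij hj
      have a1 : i < m + 1 := by omega
      have a2 : j < m + 1 := by omega
      simp only [p, a1, a2, dif_pos]
      exact f.strictMono (by simpa using hij)
    have key := main_seq p m hmp (fun i hi => hP _ (hpP i hi)) hlt C C S hS
      (fun i hi => h1 _ (hpP i hi)) (fun i hi => h2 _ (hpP i hi))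
    have h3 : P.card ^ 3 ≤ (2 * m) ^ 3 := Nat.pow_le_pow_left (by omega) 3
    calc P.card ^ 3 * (C.card * C.card) ≤ (2 * m) ^ 3 * (C.card * C.card) :=
          Nat.mul_le_mul_right _ h3
      _ = 8 * (m ^ 3 * (C.card * C.card)) := by ring
      _ ≤ 8 * (32 * S.card ^ 4) := Nat.mul_le_mul_left _ key
      _ = _ := by ring

lemma main_neg (P C S : Finset ℝ) (hP : ∀ x ∈ P, x < 0)
    (h1 : ∀ x ∈ P, ∀ c ∈ C, x + c ∈ S) (h2 : ∀ x ∈ P, ∀ c ∈ C, x⁻¹ + c ∈ S) :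
    P.card ^ 3 * (C.card * C.card) ≤ 256 * S.card ^ 4 := by
  have hc : ∀ T : Finset ℝ, (T.image (fun x => -x)).card = T.card := fun T =>
    card_image_of_injective _ neg_injective
  have := main_pos (P.image (fun x => -x)) (C.image (fun x => -x)) (S.image (fun x => -x))
    (by
      intro x hx
      obtain ⟨y, hy, rfl⟩ := mem_image.1 hx
      have := hP y hy
      linarith)
    (by
      intro x hx c hc
      obtain ⟨y, hy, rfl⟩ := mem_image.1 hx
      obtain ⟨z, hz, rfl⟩ := mem_image.1 hc
      exact mem_image.2 ⟨_, h1 y hy z hz, by ring⟩)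
    (by
      intro x hx c hc
      obtain ⟨y, hy, rfl⟩ := mem_image.1 hx
      obtain ⟨z, hz, rfl⟩ := mem_image.1 hc
      exact mem_image.2 ⟨_, h2 y hy z hz, by rw [inv_neg]; ring⟩)
  simpa only [hc] using this

lemma main_nat (A : Finset ℝ) (hA : ∀ a ∈ A, a ≠ 0) :
    (Finset.image₂ (· / ·) A A).card ^ 3 * (A.card * A.card) ≤
      2048 * (Finset.image₂ (· + ·) (Finset.image₂ (· / ·) A A) A).card ^ 4 := by
  set Q := Finset.image₂ (· / ·) A A with hQ
  set S := Finset.image₂ (· + ·) Q A with hS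
  have hinv : ∀ x ∈ Q, x⁻¹ ∈ Q := by
    intro x hx
    obtain ⟨a, ha, b, hb, rfl⟩ := mem_image₂.1 hx
    exact mem_image₂.2 ⟨b, hb, a, ha, by simp⟩
  have hne : ∀ x ∈ Q, x ≠ 0 := by
    intro x hx
    obtain ⟨a, ha, b, hb, rfl⟩ := mem_image₂.1 hx
    exact div_ne_zero (hA a ha) (hA b hb)
  have hadd : ∀ x ∈ Q, ∀ c ∈ A, x + c ∈ S := fun x hx c hc =>
    mem_image₂.2 ⟨x, hx, c, hc, rfl⟩
  have k1 := main_pos (Q.filter (fun x => 0 < x)) A S (fun x hx => (mem_filter.1 hx).2)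
    (fun x hx => hadd x (mem_filter.1 hx).1)
    (fun x hx => hadd _ (hinv x (mem_filter.1 hx).1))
  have k2 := main_neg (Q.filter (fun x => ¬ 0 < x)) A S
    (fun x hx => lt_of_le_of_ne (not_lt.1 (mem_filter.1 hx).2) (hne x (mem_filter.1 hx).1))
    (fun x hx => hadd x (mem_filter.1 hx).1)
    (fun x hx => hadd _ (hinv x (mem_filter.1 hx).1))
  have hsum := card_filter_add_card_filter_not (s := Q) (fun x => 0 < x)
  have fin : ∀ n : ℕ, Q.card ≤ 2 * n → n ^ 3 * (A.card * A.card) ≤ 256 * S.card ^ 4 →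
      Q.card ^ 3 * (A.card * A.card) ≤ 2048 * S.card ^ 4 := by
    intro n hn hk
    calc Q.card ^ 3 * (A.card * A.card) ≤ (2 * n) ^ 3 * (A.card * A.card) :=
          Nat.mul_le_mul_right _ (Nat.pow_le_pow_left hn 3)
      _ = 8 * (n ^ 3 * (A.card * A.card)) := by ring
      _ ≤ 8 * (256 * S.card ^ 4) := Nat.mul_le_mul_left _ hk
      _ = _ := by ring
  rcases le_total (Q.filter (fun x => 0 < x)).card (Q.filter (fun x => ¬ 0 < x)).card with h | h
  · exact fin _ (by omega) k2
  · exact fin _ (by omega) k1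

theorem enr_corollary :
    ∃ c : ℝ, 0 < c ∧ ∀ A : Finset ℝ, A.Nonempty → (∀ a ∈ A, a ≠ 0) →
      c * ((Finset.image₂ (· / ·) A A).card : ℝ) ^ ((3 : ℝ) / 4) *
          (A.card : ℝ) ^ ((1 : ℝ) / 2) ≤
        ((Finset.image₂ (· + ·) (Finset.image₂ (· / ·) A A) A).card : ℝ) := by
  refine ⟨1 / 8, by norm_num, ?_⟩
  intro A _ hA
  have key := main_nat A hA
  generalize (Finset.image₂ (· + ·) (Finset.image₂ (· / ·) A A) A).card = s at key ⊢
  generalize (Finset.image₂ (· / ·) A A).card = q at key ⊢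
  generalize A.card = a at key ⊢
  have key' : (q : ℝ) ^ 3 * ((a : ℝ) * a) ≤ 2048 * (s : ℝ) ^ 4 := by exact_mod_cast key
  have e1 : ((q : ℝ) ^ ((3 : ℝ) / 4)) ^ 4 = (q : ℝ) ^ 3 := by
    rw [← Real.rpow_natCast, ← Real.rpow_mul (by positivity), ← Real.rpow_natCast]
    norm_num
  have e2 : ((a : ℝ) ^ ((1 : ℝ) / 2)) ^ 4 = (a : ℝ) * a := by
    rw [← Real.rpow_natCast, ← Real.rpow_mul (by positivity), ← pow_two, ← Real.rpow_natCast]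
    norm_num
  refine le_of_pow_le_pow_left₀ (n := 4) (by norm_num) (by positivity) ?_
  rw [mul_pow, mul_pow, e1, e2]
  have : (0 : ℝ) ≤ (s : ℝ) ^ 4 := by positivity
  linarith
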